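/- Let G be the simple graph on six vertices v1,...,v6 whose edges are the path edges v1v2, v2v3, v3v4, v4v5, v5v6 together with the chords v1v3 and v4v6 (this is the graph G^6_77 in Harary's enumeration of six-vertex graphs). Then for every integer n ≥ 6, the crossing number of the Cartesian product G □ C_n equals 2n. -/

import Mathlib

open SimpleGraph

/-- A drawing of a simple graph in the plane: vertices are mapped to distinct
points, and each edge is mapped to a simple arc (parametrised by `[0,1]`)
joining the images of its endpoints and avoiding the images of all vertices
in its interior. -/
structure Drawing {V : Type*} (G : SimpleGraph V) where
  vertexMap : V → ℝ × ℝ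
  vertexMap_injective : Function.Injective vertexMap
  arc : G.edgeSet → ℝ → ℝ × ℝ
  arc_continuousOn : ∀ e, ContinuousOn (arc e) (Set.Icc 0 1)
  arc_injOn : ∀ e, Set.InjOn (arc e) (Set.Icc 0 1)
  arc_endpoints : ∀ e : G.edgeSet, ∃ u v : V,
    (e : Sym2 V) = s(u, v) ∧ arc e 0 = vertexMap u ∧ arc e 1 = vertexMap v
  arc_avoids_vertices : ∀ e : G.edgeSet, ∀ t ∈ Set.Ioo (0 : ℝ) 1, ∀ w : V,
    arc e t ≠ vertexMap w

/-- The crossings of a drawing: an unordered pair of distinct edges together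
with a point of the plane where the two corresponding arcs intersect away
from their endpoints. -/
def Drawing.crossings {V : Type*} {G : SimpleGraph V} (D : Drawing G) :
    Set (Sym2 G.edgeSet × (ℝ × ℝ)) :=
  { x | ∃ e f : G.edgeSet, e ≠ f ∧ x.1 = s(e, f) ∧
      (∃ s ∈ Set.Ioo (0 : ℝ) 1, D.arc e s = x.2) ∧
      (∃ t ∈ Set.Ioo (0 : ℝ) 1, D.arc f t = x.2) }

/-- The crossing number of a simple graph: the minimum number of crossings
over all drawings of the graph in the plane. -/
noncomputable def crossingNumber {V : Type*} (G : SimpleGraph V) : ℕ :=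
  sInf { n : ℕ | ∃ D : Drawing G, D.crossings.Finite ∧ D.crossings.ncard = n }

/-- The graph `G⁶₇₇`: the path `v1 v2 v3 v4 v5 v6` together with the chords `v1v3` and `v4v6`. -/
def G6_77 : SimpleGraph (Fin 6) :=
  SimpleGraph.fromEdgeSet {s(0, 1), s(1, 2), s(2, 3), s(3, 4), s(4, 5), s(0, 2), s(3, 5)}

open scoped unitInterval

instance : ContractibleSpace I := (convex_Icc (0 : ℝ) 1).contractibleSpace ⟨0, by simp⟩

instance : LocallyPathConnectedSpace I := (convex_Icc (0 : ℝ) 1).locallyPathConnectedSpace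

/-- The total change of the logarithm of `γ - v` along the curve `γ`. -/
noncomputable def logChange (γ : C(I, ℂ)) (v : ℂ) : ℂ :=
  open Classical in
  if h : ∃ g : C(I, ℂ), ∀ s, Complex.exp (g s) = γ s - v then h.choose 1 - h.choose 0 else 0

theorem logChange_eq {γ : C(I, ℂ)} {v : ℂ} (g : C(I, ℂ))
    (hg : ∀ s, Complex.exp (g s) = γ s - v) : logChange γ v = g 1 - g 0 := by
  have h : ∃ g : C(I, ℂ), ∀ s, Complex.exp (g s) = γ s - v := ⟨g, hg⟩
  rw [logChange, dif_pos h]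
  obtain ⟨F, -, hF⟩ := Complex.isCoveringMapOn_exp.existsUnique_continuousMap_lifts
    (γ - .const I v) (a₀ := 0) (e₀ := g 0) (by simp [hg])
    (fun a => by simp [← hg, Complex.exp_ne_zero])
  have hshift : Complex.exp (g 0 - h.choose 0) = 1 := by
    rw [Complex.exp_sub, hg, h.choose_spec, div_self]
    rw [← hg]; exact Complex.exp_ne_zero _
  have h₁ := hF g ⟨rfl, funext fun s => by simp [hg]⟩
  have h₂ := hF (h.choose + .const I (g 0 - h.choose 0)) ⟨by simp, funext fun s => by
    simp only [Function.comp_apply, ContinuousMap.add_apply, ContinuousMap.const_apply,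
      Complex.exp_add, hshift, h.choose_spec, ContinuousMap.sub_apply, mul_one]⟩
  have h₃ : g 1 = h.choose 1 + (g 0 - h.choose 0) := by
    rw [h₁, ← h₂]
    conv_rhs => rw [h₁, ← h₂]
    simp
  rw [h₃]; ring

theorem exists_log_sub {γ δ : C(I, ℂ)} (h : ∀ s t, γ s ≠ δ t) :
    ∃ g : C(I × I, ℂ), ∀ s t, Complex.exp (g (s, t)) = γ s - δ t := by
  have h0 : γ 0 - δ 0 ≠ 0 := sub_ne_zero.2 (h 0 0)
  obtain ⟨F, hF, -⟩ := Complex.isCoveringMapOn_exp.existsUnique_continuousMap_lifts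
    (γ.comp ⟨Prod.fst, continuous_fst⟩ - δ.comp ⟨Prod.snd, continuous_snd⟩)
    (a₀ := ((0, 0) : I × I)) (e₀ := Complex.log (γ 0 - δ 0)) (by simp [Complex.exp_log h0])
    (fun a => by simpa [sub_eq_zero] using h a.1 a.2)
  exact ⟨F, fun s t => by simpa using congrFun hF.2 (s, t)⟩

theorem logChange_square {γ δ : C(I, ℂ)} (h : ∀ s t, γ s ≠ δ t) :
    logChange γ (δ 0) + logChange δ (γ 1) = logChange δ (γ 0) + logChange γ (δ 1) := by
  obtain ⟨g, hg⟩ := exists_log_sub h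
  have hγ (t : I) : logChange γ (δ t) = g (1, t) - g (0, t) :=
    logChange_eq ⟨fun s => g (s, t), by fun_prop⟩ fun s => hg s t
  have hδ (s : I) : logChange δ (γ s) = g (s, 1) - g (s, 0) := by
    rw [logChange_eq ⟨fun t => g (s, t) + Real.pi * Complex.I, by fun_prop⟩ fun t => by
      simp [Complex.exp_add, hg]]
    simp
  rw [hγ, hγ, hδ, hδ]; ring

theorem exp_logChange {γ : C(I, ℂ)} {v : ℂ} (h : ∀ s, γ s ≠ v) :
    Complex.exp (logChange γ v) = (γ 1 - v) / (γ 0 - v) := by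
  obtain ⟨g, hg⟩ := exists_log_sub (δ := .const I v) (fun s _ => h s)
  rw [logChange_eq (v := v) ⟨fun s => g (s, 0), by fun_prop⟩ fun s => hg s 0]
  simp [Complex.exp_sub, hg]

/-- In every continuous drawing of `K₅` in the plane two independent edges meet. -/
theorem exists_independent_edges_meet (q : Fin 5 → ℂ) (γ : Fin 5 → Fin 5 → C(I, ℂ))
    (h0 : ∀ i j, i < j → γ i j 0 = q i) (h1 : ∀ i j, i < j → γ i j 1 = q j) :
    ∃ i j k l, i < j ∧ k < l ∧ i ≠ k ∧ i ≠ l ∧ j ≠ k ∧ j ≠ l ∧ ∃ s t, γ i j s = γ k l t := by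
  by_contra! hne
  have hoff (i j k : Fin 5) (hij : i < j) (hik : i ≠ k) (hjk : j ≠ k) (s : I) :
      γ i j s ≠ q k := by
    obtain ⟨l, hlk, hli, hlj⟩ : ∃ l, l ≠ k ∧ l ≠ i ∧ l ≠ j := by decide +revert
    rcases lt_or_gt_of_ne hlk with h | h
    · rw [← h1 l k h]; exact hne _ _ _ _ hij h hli.symm hik hlj.symm hjk s 1
    · rw [← h0 k l h]; exact hne _ _ _ _ hij h hik hli.symm hjk hlj.symm s 0
  have hq (i k : Fin 5) (hik : i < k) : q i - q k ≠ 0 := by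
    obtain ⟨l, hli, hlk⟩ : ∃ l, l ≠ i ∧ l ≠ k := by decide +revert
    rw [sub_ne_zero]
    rcases lt_or_gt_of_ne hli with h | h
    · rw [← h1 l i h]; exact hoff _ _ _ h hlk hik.ne 1
    · rw [← h0 i l h]; exact hoff _ _ _ h hik.ne hlk 0
  let L (i k : Fin 5) : ℂ := if i < k then Complex.log (q i - q k)
    else Complex.log (q k - q i) + Real.pi * Complex.I
  have hL (i k : Fin 5) (hik : i ≠ k) : Complex.exp (L i k) = q i - q k := by
    rcases lt_or_gt_of_ne hik with h | h
    · simp [L, h, Complex.exp_log (hq i k h)]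
    · simp [L, h.not_gt, Complex.exp_add, Complex.exp_log (hq k i h)]
  let ε (i k : Fin 5) : ℤ := if i < k then -1 else 1
  have hε (i k : Fin 5) (hik : i ≠ k) : L i k - L k i = ε i k * (Real.pi * Complex.I) := by
    rcases lt_or_gt_of_ne hik with h | h
    · simp [L, ε, h, h.not_gt]
    · simp [L, ε, h, h.not_gt]
  have hn (i j k : Fin 5) (h : i < j ∧ i ≠ k ∧ j ≠ k) : ∃ n : ℤ,
      logChange (γ i j) (q k) = L j k - L i k + n * (2 * Real.pi * Complex.I) := by
    obtain ⟨hij, hik, hjk⟩ := h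
    rw [← Complex.exp_eq_exp_iff_exists_int, exp_logChange (hoff i j k hij hik hjk),
      Complex.exp_sub, hL _ _ hjk, hL _ _ hik, h0 _ _ hij, h1 _ _ hij]
  choose! n hn using hn
  have key (i j k l : Fin 5) (hij : i < j) (hkl : k < l) (hik : i ≠ k) (hil : i ≠ l)
      (hjk : j ≠ k) (hjl : j ≠ l) :
      2 * (n i j k + n k l j - n i j l - n k l i) = - ε j k + ε i k + ε j l - ε i l := by
    have h := logChange_square (hne i j k l hij hkl hik hil hjk hjl)
    rw [h0 _ _ hij, h1 _ _ hij, h0 _ _ hkl, h1 _ _ hkl, hn _ _ _ ⟨hij, hik, hjk⟩,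
      hn _ _ _ ⟨hij, hil, hjl⟩, hn _ _ _ ⟨hkl, hik.symm, hil.symm⟩,
      hn _ _ _ ⟨hkl, hjk.symm, hjl.symm⟩] at h
    have hπ : (Real.pi * Complex.I : ℂ) ≠ 0 := by simp [Real.pi_ne_zero]
    have : ((2 * (n i j k + n k l j - n i j l - n k l i) : ℤ) : ℂ)
        = ((- ε j k + ε i k + ε j l - ε i l : ℤ) : ℂ) := by
      apply mul_right_cancel₀ hπ
      push_cast
      linear_combination h - hε j k hjk + hε i k hik + hε j l hjl - hε i l hil
    exact_mod_cast this
  have e₁ := key 0 1 2 3 (by decide) (by decide) (by decide) (by decide) (by decide) (by decide)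
  have e₂ := key 0 1 2 4 (by decide) (by decide) (by decide) (by decide) (by decide) (by decide)
  have e₃ := key 0 1 3 4 (by decide) (by decide) (by decide) (by decide) (by decide) (by decide)
  have e₄ := key 0 2 1 3 (by decide) (by decide) (by decide) (by decide) (by decide) (by decide)
  have e₅ := key 0 2 1 4 (by decide) (by decide) (by decide) (by decide) (by decide) (by decide)
  have e₆ := key 0 2 3 4 (by decide) (by decide) (by decide) (by decide) (by decide) (by decide)
  have e₇ := key 0 3 1 2 (by decide) (by decide) (by decide) (by decide) (by decide) (by decide)
  have e₈ := key 0 3 1 4 (by decide) (by decide) (by decide) (by decide) (by decide) (by decide)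
  have e₉ := key 0 3 2 4 (by decide) (by decide) (by decide) (by decide) (by decide) (by decide)
  have e₁₀ := key 0 4 1 2 (by decide) (by decide) (by decide) (by decide) (by decide) (by decide)
  have e₁₁ := key 0 4 1 3 (by decide) (by decide) (by decide) (by decide) (by decide) (by decide)
  have e₁₂ := key 0 4 2 3 (by decide) (by decide) (by decide) (by decide) (by decide) (by decide)
  have e₁₃ := key 1 2 3 4 (by decide) (by decide) (by decide) (by decide) (by decide) (by decide)
  have e₁₄ := key 1 3 2 4 (by decide) (by decide) (by decide) (by decide) (by decide) (by decide)
  have e₁₅ := key 1 4 2 3 (by decide) (by decide) (by decide) (by decide) (by decide) (by decide)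
  simp only [ε, show ∀ a b : Fin 5, (a < b) = (a.val < b.val) from fun _ _ => rfl] at *
  norm_num at e₁ e₂ e₃ e₄ e₅ e₆ e₇ e₈ e₉ e₁₀ e₁₁ e₁₂ e₁₃ e₁₄ e₁₅
  clear * - e₁ e₂ e₃ e₄ e₅ e₆ e₇ e₈ e₉ e₁₀ e₁₁ e₁₂ e₁₃ e₁₄ e₁₅
  omega

/-- Among plane sets joining five points pairwise, two sets belonging to disjoint pairs meet. -/
theorem exists_independent_sets_meet (q : Fin 5 → ℝ × ℝ) (A : Fin 5 → Fin 5 → Set (ℝ × ℝ))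
    (hA : ∀ i j, i < j → JoinedIn (A i j) (q i) (q j)) :
    ∃ i j k l, i < j ∧ k < l ∧ i ≠ k ∧ i ≠ l ∧ j ≠ k ∧ j ≠ l ∧ (A i j ∩ A k l).Nonempty := by
  let φ := Complex.equivRealProdCLM.symm
  have hγ (i j : Fin 5) : ∃ γ : C(I, ℝ × ℝ), i < j →
      γ 0 = q i ∧ γ 1 = q j ∧ ∀ t, γ t ∈ A i j := by
    by_cases h : i < j
    · exact ⟨(hA i j h).somePath, fun _ => ⟨by simp, by simp, (hA i j h).somePath_mem⟩⟩
    · exact ⟨.const I 0, fun h' => absurd h' h⟩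
  choose γ hγ using hγ
  obtain ⟨i, j, k, l, hij, hkl, hik, hil, hjk, hjl, s, t, hst⟩ :=
    exists_independent_edges_meet (fun i => φ (q i))
      (fun i j => ⟨fun t => φ (γ i j t), by fun_prop⟩)
      (fun i j h => by simp [(hγ i j h).1]) (fun i j h => by simp [(hγ i j h).2.1])
  refine ⟨i, j, k, l, hij, hkl, hik, hil, hjk, hjl, γ i j s, (hγ i j hij).2.2 s, ?_⟩
  rw [φ.injective hst]
  exact (hγ k l hkl).2.2 t

/-- The edges of `K₃ □ K₃`, seen as a `3 × 3` grid: `(false, c, r)` lies in column `c`, opposite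
to row `r`, and `(true, c, r)` lies in row `r`, opposite to column `c`. -/
abbrev GridEdge := Bool × Fin 3 × Fin 3

/-- The vertices of the `K₅`-subdivision of `K₃ □ K₃` formed by column `c` and row `r`. -/
def crossVertex (c r : Fin 3) : Fin 5 → Fin 3 × Fin 3 :=
  ![(c, r), (c, r + 1), (c, r + 2), (c + 1, r), (c + 2, r)]

/-- The paths of the `K₅`-subdivision of `K₃ □ K₃` formed by column `c` and row `r`. -/
def crossPath (c r : Fin 3) : Fin 5 → Fin 5 → List GridEdge
  | 0, 1 => [(false, c, r + 2)]
  | 0, 2 => [(false, c, r + 1)]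
  | 0, 3 => [(true, c + 2, r)]
  | 0, 4 => [(true, c + 1, r)]
  | 1, 2 => [(false, c, r)]
  | 1, 3 => [(true, c + 2, r + 1), (false, c + 1, r + 2)]
  | 1, 4 => [(true, c + 1, r + 1), (false, c + 2, r + 2)]
  | 2, 3 => [(true, c + 2, r + 2), (false, c + 1, r + 1)]
  | 2, 4 => [(true, c + 1, r + 2), (false, c + 2, r + 1)]
  | 3, 4 => [(true, c, r)]
  | _, _ => []

/-- The pairs of grid edges that lie on independent paths of `crossPath c r`. -/
def crossPairs (c r : Fin 3) : List (GridEdge × GridEdge) :=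
  [(0, 1, 2, 3), (0, 1, 2, 4), (0, 1, 3, 4), (0, 2, 1, 3), (0, 2, 1, 4), (0, 2, 3, 4),
    (0, 3, 1, 2), (0, 3, 1, 4), (0, 3, 2, 4), (0, 4, 1, 2), (0, 4, 1, 3), (0, 4, 2, 3),
    (1, 2, 3, 4), (1, 3, 2, 4), (1, 4, 2, 3)].flatMap
      fun x : Fin 5 × Fin 5 × Fin 5 × Fin 5 =>
        crossPath c r x.1 x.2.1 ×ˢ crossPath c r x.2.2.1 x.2.2.2

theorem mem_crossPairs {c r : Fin 3} {i j k l : Fin 5} (hij : i < j) (hkl : k < l) (hik : i ≠ k)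
    (hil : i ≠ l) (hjk : j ≠ k) (hjl : j ≠ l) {a b : GridEdge} (ha : a ∈ crossPath c r i j)
    (hb : b ∈ crossPath c r k l) : (a, b) ∈ crossPairs c r ∨ (b, a) ∈ crossPairs c r := by
  have h : (i, j, k, l) ∈ [(0, 1, 2, 3), (0, 1, 2, 4), (0, 1, 3, 4), (0, 2, 1, 3), (0, 2, 1, 4),
      (0, 2, 3, 4), (0, 3, 1, 2), (0, 3, 1, 4), (0, 3, 2, 4), (0, 4, 1, 2), (0, 4, 1, 3),
      (0, 4, 2, 3), (1, 2, 3, 4), (1, 3, 2, 4), ((1, 4, 2, 3) : Fin 5 × Fin 5 × Fin 5 × Fin 5)] ∨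
      (k, l, i, j) ∈ [(0, 1, 2, 3), (0, 1, 2, 4), (0, 1, 3, 4), (0, 2, 1, 3), (0, 2, 1, 4),
      (0, 2, 3, 4), (0, 3, 1, 2), (0, 3, 1, 4), (0, 3, 2, 4), (0, 4, 1, 2), (0, 4, 1, 3),
      (0, 4, 2, 3), (1, 2, 3, 4), (1, 3, 2, 4), ((1, 4, 2, 3) : Fin 5 × Fin 5 × Fin 5 × Fin 5)] := by
    clear ha hb
    decide +revert
  exact h.imp (fun h => List.mem_flatMap.2 ⟨_, h, List.mem_product.2 ⟨ha, hb⟩⟩)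
    (fun h => List.mem_flatMap.2 ⟨_, h, List.mem_product.2 ⟨hb, ha⟩⟩)

/-- In a plane drawing of `K₃ □ K₃`, two grid edges on independent paths of any of the nine
`K₅`-subdivisions formed by a column and a row meet. -/
theorem exists_crossPairs_meet (p : Fin 3 → Fin 3 → ℝ × ℝ) (A : GridEdge → Set (ℝ × ℝ))
    (hcol : ∀ c r, JoinedIn (A (false, c, r)) (p c (r + 1)) (p c (r + 2)))
    (hrow : ∀ c r, JoinedIn (A (true, c, r)) (p (c + 1) r) (p (c + 2) r)) (c r : Fin 3) :
    ∃ x ∈ crossPairs c r, (A x.1 ∩ A x.2).Nonempty := by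
  have third (x y z : Fin 3) (h : x ≠ y ∧ z ≠ x ∧ z ≠ y) :
      (x = z + 1 ∧ y = z + 2) ∨ (y = z + 1 ∧ x = z + 2) := by decide +revert
  have hcol' (c r x y : Fin 3) (h : x ≠ y ∧ r ≠ x ∧ r ≠ y) :
      JoinedIn (A (false, c, r)) (p c x) (p c y) := by
    obtain ⟨rfl, rfl⟩ | ⟨rfl, rfl⟩ := third x y r h
    exacts [hcol c r, (hcol c r).symm]
  have hrow' (c r x y : Fin 3) (h : x ≠ y ∧ c ≠ x ∧ c ≠ y) :
      JoinedIn (A (true, c, r)) (p x r) (p y r) := by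
    obtain ⟨rfl, rfl⟩ | ⟨rfl, rfl⟩ := third x y c h
    exacts [hrow c r, (hrow c r).symm]
  have single {a : GridEdge} {x y : ℝ × ℝ} {l : List GridEdge} (ha : a ∈ l)
      (h : JoinedIn (A a) x y) : JoinedIn (⋃ a ∈ l, A a) x y :=
    h.mono (Set.subset_biUnion_of_mem (u := A) ha)
  obtain ⟨i, j, k, l, hij, hkl, hik, hil, hjk, hjl, z, hz₁, hz₂⟩ :=
    exists_independent_sets_meet (fun i => p (crossVertex c r i).1 (crossVertex c r i).2)
      (fun i j => ⋃ a ∈ crossPath c r i j, A a) (by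
        intro i j hij
        fin_cases i <;> fin_cases j <;> first | exact absurd hij (by decide) | skip
        · exact single (List.mem_singleton_self _) (hcol' _ _ _ _ (by decide +revert))
        · exact single (List.mem_singleton_self _) (hcol' _ _ _ _ (by decide +revert))
        · exact single (List.mem_singleton_self _) (hrow' _ _ _ _ (by decide +revert))
        · exact single (List.mem_singleton_self _) (hrow' _ _ _ _ (by decide +revert))
        · exact single (List.mem_singleton_self _) (hcol' _ _ _ _ (by decide +revert))
        · exact (single (List.mem_cons_self ..) (hrow' _ _ _ (c + 1) (by decide +revert))).trans
            (single (List.mem_cons_of_mem _ (List.mem_singleton_self _))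
              (hcol' _ _ _ _ (by decide +revert)))
        · exact (single (List.mem_cons_self ..) (hrow' _ _ _ (c + 2) (by decide +revert))).trans
            (single (List.mem_cons_of_mem _ (List.mem_singleton_self _))
              (hcol' _ _ _ _ (by decide +revert)))
        · exact (single (List.mem_cons_self ..) (hrow' _ _ _ (c + 1) (by decide +revert))).trans
            (single (List.mem_cons_of_mem _ (List.mem_singleton_self _))
              (hcol' _ _ _ _ (by decide +revert)))
        · exact (single (List.mem_cons_self ..) (hrow' _ _ _ (c + 2) (by decide +revert))).trans
            (single (List.mem_cons_of_mem _ (List.mem_singleton_self _))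
              (hcol' _ _ _ _ (by decide +revert)))
        · exact single (List.mem_singleton_self _) (hrow' _ _ _ _ (by decide +revert)))
  obtain ⟨a, ha, hza⟩ := Set.mem_iUnion₂.1 hz₁
  obtain ⟨b, hb, hzb⟩ := Set.mem_iUnion₂.1 hz₂
  rcases mem_crossPairs hij hkl hik hil hjk hjl ha hb with h | h
  exacts [⟨_, h, z, hza, hzb⟩, ⟨_, h, z, hzb, hza⟩]

/-- The possible sets of `K₅`-subdivisions of `K₃ □ K₃` obstructed by a pair of grid edges: a
column, a row, or a cell together with the four cells in none of its lines. -/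
def obstruction : Fin 3 ⊕ Fin 3 ⊕ Fin 3 × Fin 3 → Fin 3 × Fin 3 → Bool
  | .inl c, w => w.1 = c
  | .inr (.inl r), w => w.2 = r
  | .inr (.inr v), w => w = v ∨ w.1 ≠ v.1 ∧ w.2 ≠ v.2

set_option synthInstance.maxHeartbeats 200000 in
set_option synthInstance.maxSize 1000 in
theorem exists_obstruction (a b : GridEdge) : ∃ o, ∀ w : Fin 3 × Fin 3,
    (a, b) ∈ crossPairs w.1 w.2 ++ (crossPairs w.1 w.2).map Prod.swap → obstruction o w := by
  revert a b
  decide +kernel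

theorem exists_not_obstruction (o t : Fin 3 ⊕ Fin 3 ⊕ Fin 3 × Fin 3) :
    ∃ w, ¬ obstruction o w ∧ ¬ obstruction t w := by
  revert o t
  decide +kernel

/-- A family of pairs of grid edges that obstructs all nine `K₅`-subdivisions formed by a column
and a row has at least three members. -/
theorem three_le_card_of_crossPairs {κ : Type*} (C : Finset κ)
    (R : κ → GridEdge → GridEdge → Prop)
    (hR : ∀ x a b a' b', R x a b → R x a' b' → a' = a ∧ b' = b ∨ a' = b ∧ b' = a)
    (hC : ∀ c r, ∃ y ∈ crossPairs c r, ∃ x ∈ C, R x y.1 y.2) : 3 ≤ C.card := by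
  have ho (x : κ) : ∃ o, ∀ w : Fin 3 × Fin 3, ∀ y ∈ crossPairs w.1 w.2,
      R x y.1 y.2 → obstruction o w := by
    by_cases h : ∃ a b, R x a b
    · obtain ⟨a, b, hab⟩ := h
      obtain ⟨o, ho⟩ := exists_obstruction a b
      refine ⟨o, fun w y hy hxy => ho w (List.mem_append.2 ?_)⟩
      obtain ⟨a', b'⟩ := y
      rcases hR x a b a' b' hab hxy with ⟨rfl, rfl⟩ | ⟨rfl, rfl⟩
      exacts [.inl hy, .inr (List.mem_map_of_mem (f := Prod.swap) hy)]
    · exact ⟨.inl 0, fun w y _ hxy => (h ⟨_, _, hxy⟩).elim⟩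
  choose o ho using ho
  by_contra! h
  obtain ⟨x, x', hx⟩ : ∃ x x', ∀ z ∈ C, z = x ∨ z = x' := by
    obtain ⟨_, _, x₀, _⟩ := hC 0 0
    interval_cases hc : C.card
    · exact ⟨x₀, x₀, by simp [Finset.card_eq_zero.1 hc]⟩
    · obtain ⟨x, rfl⟩ := Finset.card_eq_one.1 hc
      exact ⟨x, x, by simp⟩
    · classical
      obtain ⟨x, y, -, rfl⟩ := Finset.card_eq_two.1 hc
      exact ⟨x, y, by simp⟩
  obtain ⟨w, h₁, h₂⟩ := exists_not_obstruction (o x) (o x')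
  obtain ⟨y, hy, z, hz, hzy⟩ := hC w.1 w.2
  rcases hx z hz with rfl | rfl
  exacts [h₁ (ho _ w y hy hzy), h₂ (ho _ w y hy hzy)]

/-- Grid edges without a common vertex. -/
def GridEdge.Disjoint : GridEdge → GridEdge → Prop
  | (false, c, _), (false, c', _) => c ≠ c'
  | (false, c, r), (true, c', r') => c = c' ∨ r = r'
  | (true, c, r), (false, c', r') => c = c' ∨ r = r'
  | (true, _, r), (true, _, r') => r ≠ r'

theorem disjoint_of_mem_crossPairs {c r : Fin 3} {x : GridEdge × GridEdge}
    (hx : x ∈ crossPairs c r) : x.1.Disjoint x.2 := by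
  obtain ⟨⟨β, a, s⟩, β', a', s'⟩ := x
  cases β <;> cases β' <;> simp only [GridEdge.Disjoint] <;> revert hx <;> revert c r a s a' s' <;>
    decide +kernel

/-- An obstruction to the `K₅`-subdivision formed by column `c` and row `r` which does not involve
column edges consists of two row edges on different sides of column `c`. -/
theorem row_pair_of_mem_crossPairs {c r : Fin 3} {x : GridEdge × GridEdge}
    (hx : x ∈ crossPairs c r) (h₁ : x.1.1 = true) (h₂ : x.2.1 = true) :
    x.1.2.1 = c + 1 ∧ x.2.2.1 = c + 2 ∨ x.1.2.1 = c + 2 ∧ x.2.2.1 = c + 1 := by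
  obtain ⟨⟨β, a, s⟩, β', a', s'⟩ := x
  simp only at h₁ h₂
  subst h₁ h₂
  revert c r a s a' s'
  decide +kernel

namespace Drawing

variable {V : Type*} {G : SimpleGraph V} (D : Drawing G)

/-- The set of points on the arc of an edge, endpoints included. -/
def curve (e : G.edgeSet) : Set (ℝ × ℝ) := D.arc e '' Set.Icc 0 1

theorem joinedIn_curve {e : G.edgeSet} {u v : V} (h : (e : Sym2 V) = s(u, v)) :
    JoinedIn (D.curve e) (D.vertexMap u) (D.vertexMap v) := by
  have hpc : IsPathConnected (D.curve e) :=
    ((convex_Icc (0 : ℝ) 1).isPathConnected ⟨0, by simp⟩).image' (D.arc_continuousOn e)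
  obtain ⟨u', v', he, h₀, h₁⟩ := D.arc_endpoints e
  have hu' : D.vertexMap u' ∈ D.curve e := ⟨0, by simp, h₀⟩
  have hv' : D.vertexMap v' ∈ D.curve e := ⟨1, by simp, h₁⟩
  rcases Sym2.eq_iff.1 (h.symm.trans he) with ⟨rfl, rfl⟩ | ⟨rfl, rfl⟩
  exacts [hpc.joinedIn _ hu' _ hv', hpc.joinedIn _ hv' _ hu']

theorem interior_or_vertex_of_mem_curve {e : G.edgeSet} {z : ℝ × ℝ} (hz : z ∈ D.curve e) :
    (∃ s ∈ Set.Ioo (0 : ℝ) 1, D.arc e s = z) ∨ ∃ w ∈ (e : Sym2 V), D.vertexMap w = z := by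
  obtain ⟨s, ⟨hs₀, hs₁⟩, rfl⟩ := hz
  obtain ⟨u, v, he, h₀, h₁⟩ := D.arc_endpoints e
  rcases hs₀.eq_or_lt with rfl | hs₀
  · exact .inr ⟨u, by simp [he], h₀.symm⟩
  rcases hs₁.eq_or_lt with rfl | hs₁
  · exact .inr ⟨v, by simp [he], h₁.symm⟩
  exact .inl ⟨s, ⟨hs₀, hs₁⟩, rfl⟩

/-- A common point of the curves of two edges without a common vertex is a crossing. -/
theorem mem_crossings_of_disjoint {e f : G.edgeSet}
    (hef : ∀ w, w ∈ (e : Sym2 V) → w ∉ (f : Sym2 V)) {z : ℝ × ℝ} (he : z ∈ D.curve e)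
    (hf : z ∈ D.curve f) : (s(e, f), z) ∈ D.crossings := by
  have hne : e ≠ f := by
    rintro rfl
    obtain ⟨u, v, h, -⟩ := D.arc_endpoints e
    exact hef u (by simp [h]) (by simp [h])
  rcases D.interior_or_vertex_of_mem_curve he with he | ⟨w, hw, rfl⟩
  · rcases D.interior_or_vertex_of_mem_curve hf with hf | ⟨w, hw, rfl⟩
    · exact ⟨e, f, hne, rfl, he, hf⟩
    · obtain ⟨s, hs, h⟩ := he
      exact (D.arc_avoids_vertices e s hs w h).elim
  · rcases D.interior_or_vertex_of_mem_curve hf with ⟨s, hs, h⟩ | ⟨w', hw', h⟩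
    · exact (D.arc_avoids_vertices f s hs w h).elim
    · exact (hef w hw (D.vertexMap_injective h ▸ hw')).elim

end Drawing

/-- A copy of the prism `K₃ □ Cₙ` in a graph. The edge `(false, r, u)` lies in column `u`, opposite
to row `r`, and the edge `(true, r, u)` lies in row `r`, between columns `u` and `u + 1`. -/
structure Prism {V : Type*} (G : SimpleGraph V) (n : ℕ) where
  vert : Fin 3 → ℕ → V
  vert_self : ∀ r, vert r n = vert r 0
  vert_inj : ∀ r r' u u', u < n → u' < n → vert r u = vert r' u' → r = r' ∧ u = u'
  edge : Bool × Fin 3 × ℕ → G.edgeSet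
  edge_col : ∀ r u, u < n → (edge (false, r, u) : Sym2 V) = s(vert (r + 1) u, vert (r + 2) u)
  edge_row : ∀ r u, u < n → (edge (true, r, u) : Sym2 V) = s(vert r u, vert r (u + 1))

/-- For columns `i < j < k`, the indices of the row edges on the segment opposite to the given one
of these columns. -/
def rowSegment (n i j k : ℕ) : Fin 3 → Set ℕ :=
  ![{u | j ≤ u ∧ u < k}, {u | u < n ∧ (k ≤ u ∨ u < i)}, {u | i ≤ u ∧ u < j}]

/-- The edges of a prism forming a given edge of the subdivision of `K₃ □ K₃` with columns
`i < j < k`. -/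
def gridPart (n i j k : ℕ) : GridEdge → Set (Bool × Fin 3 × ℕ)
  | (false, c, r) => {a | a.1 = false ∧ a.2.1 = r ∧ a.2.2 = ![i, j, k] c}
  | (true, c, r) => {a | a.1 = true ∧ a.2.1 = r ∧ a.2.2 ∈ rowSegment n i j k c}

theorem lt_of_mem_gridPart {n i j k : ℕ} (hij : i < j) (hjk : j < k) (hk : k < n) {g : GridEdge}
    {a : Bool × Fin 3 × ℕ} (ha : a ∈ gridPart n i j k g) : a.2.2 < n := by
  obtain ⟨_ | _, c, r⟩ := g <;> obtain ⟨-, -, h⟩ := ha <;>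
    fin_cases c <;> simp [rowSegment] at h ⊢ <;> omega

theorem eq_of_mem_gridPart {n i j k : ℕ} (hij : i < j) (hjk : j < k)
    {g g' : GridEdge} {a : Bool × Fin 3 × ℕ} (ha : a ∈ gridPart n i j k g)
    (ha' : a ∈ gridPart n i j k g') : g = g' := by
  obtain ⟨_ | _, c, r⟩ := g <;> obtain ⟨_ | _, c', r'⟩ := g' <;> obtain ⟨h₁, rfl, h⟩ := ha <;>
    obtain ⟨h₁', rfl, h'⟩ := ha' <;> simp only [Prod.mk.injEq, true_and, and_true]
  · fin_cases c <;> fin_cases c' <;> simp at h h' ⊢ <;> omega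
  · simp_all
  · simp_all
  · fin_cases c <;> fin_cases c' <;> simp [rowSegment] at h h' ⊢ <;> omega

namespace Prism

variable {V : Type*} {G : SimpleGraph V} {n : ℕ} (P : Prism G n)

theorem exists_edge_row_eq {u : ℕ} (r : Fin 3) (hu : u < n) :
    ∃ u' < n, (u' = u + 1 ∨ u + 1 = n ∧ u' = 0) ∧
      (P.edge (true, r, u) : Sym2 V) = s(P.vert r u, P.vert r u') := by
  rcases (Nat.succ_le_of_lt hu).eq_or_lt with h | h
  · exact ⟨0, by omega, .inr ⟨h, rfl⟩,
      by rw [P.edge_row r u hu, ← P.vert_self, show u + 1 = n from h]⟩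
  · exact ⟨u + 1, h, .inl rfl, P.edge_row r u hu⟩

theorem edge_inj (hn : 3 ≤ n) {a b : Bool × Fin 3 × ℕ} (ha : a.2.2 < n) (hb : b.2.2 < n)
    (h : P.edge a = P.edge b) : a = b := by
  have hne (r r' : Fin 3) {u u' : ℕ} (hu : u < n) (hu' : u' < n) :
      (P.edge (false, r, u) : Sym2 V) ≠ P.edge (true, r', u') := by
    obtain ⟨w, hw, -, hw'⟩ := P.exists_edge_row_eq r' hu'
    rw [P.edge_col r u hu, hw']
    have hadd : ∀ {r r' : Fin 3}, r + 1 = r' → r + 2 = r' → False := by decide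
    intro h
    rcases Sym2.eq_iff.1 h with ⟨h₁, h₂⟩ | ⟨h₁, h₂⟩
    · exact hadd (P.vert_inj _ _ _ _ hu hu' h₁).1 (P.vert_inj _ _ _ _ hu hw h₂).1
    · exact hadd (P.vert_inj _ _ _ _ hu hw h₁).1 (P.vert_inj _ _ _ _ hu hu' h₂).1
  have h := congrArg Subtype.val h
  obtain ⟨β, r, u⟩ := a
  obtain ⟨β', r', u'⟩ := b
  replace ha : u < n := ha
  replace hb : u' < n := hb
  cases β <;> cases β'
  · rw [P.edge_col _ _ ha, P.edge_col _ _ hb] at h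
    rcases Sym2.eq_iff.1 h with ⟨h₁, -⟩ | ⟨h₁, h₂⟩
    · obtain ⟨h₂, rfl⟩ := P.vert_inj _ _ _ _ ha hb h₁
      rw [add_right_cancel h₂]
    · have h : ∀ {r r' : Fin 3}, r + 1 = r' + 2 → r + 2 ≠ r' + 1 := by decide
      exact (h (P.vert_inj _ _ _ _ ha hb h₁).1 (P.vert_inj _ _ _ _ ha hb h₂).1).elim
  · exact (hne _ _ ha hb h).elim
  · exact (hne _ _ hb ha h.symm).elim
  · obtain ⟨w, hw, hwu, he⟩ := P.exists_edge_row_eq r ha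
    obtain ⟨w', hw', hwu', he'⟩ := P.exists_edge_row_eq r' hb
    rw [he, he'] at h
    rcases Sym2.eq_iff.1 h with ⟨h₁, -⟩ | ⟨h₁, h₂⟩
    · obtain ⟨rfl, rfl⟩ := P.vert_inj _ _ _ _ ha hb h₁
      rfl
    · have h₁ := (P.vert_inj _ _ _ _ ha hw' h₁).2
      have h₂ := (P.vert_inj _ _ _ _ hw hb h₂).2
      omega

theorem disjoint_edge {i j k : ℕ} (hij : i < j) (hjk : j < k) (hk : k < n) {g g' : GridEdge}
    (hg : g.Disjoint g') {a b : Bool × Fin 3 × ℕ} (ha : a ∈ gridPart n i j k g)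
    (hb : b ∈ gridPart n i j k g') (w : V) (hwa : w ∈ (P.edge a : Sym2 V)) :
    w ∉ (P.edge b : Sym2 V) := by
  intro hwb
  have hadd : ∀ r : Fin 3, r + 1 ≠ r ∧ r + 2 ≠ r := by decide
  have hcoord {g : GridEdge} {a : Bool × Fin 3 × ℕ} (ha : a ∈ gridPart n i j k g)
      (hw : w ∈ (P.edge a : Sym2 V)) : ∃ r u, u < n ∧ w = P.vert r u ∧
        (g.1 = false → r ≠ g.2.2 ∧ u = ![i, j, k] g.2.1) ∧
        (g.1 = true → r = g.2.2 ∧ u ≠ ![i, j, k] g.2.1) := by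
    have ha' := lt_of_mem_gridPart hij hjk hk ha
    obtain ⟨β, r, u⟩ := a
    replace ha' : u < n := ha'
    obtain ⟨_ | _, c, r'⟩ := g <;> obtain ⟨rfl, h', h⟩ := ha <;> obtain rfl : r = r' := h'
    · rw [P.edge_col r u ha', Sym2.mem_iff] at hw
      rcases hw with rfl | rfl
      · exact ⟨r + 1, u, ha', rfl, fun _ => ⟨(hadd r).1, h⟩, by simp⟩
      · exact ⟨r + 2, u, ha', rfl, fun _ => ⟨(hadd r).2, h⟩, by simp⟩
    · obtain ⟨u', hu', huu', he⟩ := P.exists_edge_row_eq r ha'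
      rw [he, Sym2.mem_iff] at hw
      rcases hw with rfl | rfl
      · refine ⟨r, u, ha', rfl, by simp, fun _ => ⟨rfl, ?_⟩⟩
        fin_cases c <;> simp [rowSegment] at h ⊢ <;> omega
      · refine ⟨r, u', hu', rfl, by simp, fun _ => ⟨rfl, ?_⟩⟩
        fin_cases c <;> simp [rowSegment] at h ⊢ <;> omega
  obtain ⟨r, u, hu, rfl, h₁, h₂⟩ := hcoord ha hwa
  obtain ⟨r', u', hu', h, h₁', h₂'⟩ := hcoord hb hwb
  obtain ⟨rfl, rfl⟩ := P.vert_inj _ _ _ _ hu hu' h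
  obtain ⟨_ | _, c, s⟩ := g <;> obtain ⟨_ | _, c', s'⟩ := g' <;>
    simp only [GridEdge.Disjoint, reduceCtorEq, forall_const, false_imp_iff] at *
  · refine hg ?_
    have h := h₁.2.symm.trans h₁'.2
    fin_cases c <;> fin_cases c' <;> simp at h ⊢ <;> omega
  · rcases hg with rfl | rfl
    exacts [h₂'.2 h₁.2, h₁.1 h₂'.1]
  · rcases hg with rfl | rfl
    exacts [h₂.2 h₁'.2, h₁'.1 h₂.1]
  · exact hg (h₂.1.symm.trans h₂'.1)

variable (D : Drawing G)

theorem joinedIn_row {A : Set (Bool × Fin 3 × ℕ)} {r : Fin 3} {l m : ℕ} (hl : l < m) (hm : m ≤ n)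
    (hA : ∀ u, l ≤ u → u < m → (true, r, u) ∈ A) :
    JoinedIn (⋃ a ∈ A, D.curve (P.edge a)) (D.vertexMap (P.vert r l))
      (D.vertexMap (P.vert r m)) := by
  have step (u : ℕ) (hu : l ≤ u) (hu' : u < m) : JoinedIn (⋃ a ∈ A, D.curve (P.edge a))
      (D.vertexMap (P.vert r u)) (D.vertexMap (P.vert r (u + 1))) :=
    (D.joinedIn_curve (P.edge_row r u (hu'.trans_le hm))).mono
      (Set.subset_biUnion_of_mem (u := fun a => D.curve (P.edge a)) (hA u hu hu'))
  induction m, hl using Nat.le_induction with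
  | base => exact step l le_rfl l.lt_succ_self
  | succ m hl ih =>
    exact (ih (by omega) (fun u h h' => hA u h (by omega)) fun u h h' => step u h (by omega)).trans
      (step m (by omega) m.lt_succ_self)

/-- For any three columns of a prism, each of the nine `K₅`-subdivisions formed by one of these
columns and a row gives rise to a crossing. -/
theorem exists_crossing {i j k : ℕ} (hij : i < j) (hjk : j < k) (hk : k < n) (c r : Fin 3) :
    ∃ y ∈ crossPairs c r, ∃ x ∈ D.crossings, ∃ a ∈ gridPart n i j k y.1,
      ∃ b ∈ gridPart n i j k y.2, x.1 = s(P.edge a, P.edge b) := by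
  obtain ⟨y, hy, z, hz₁, hz₂⟩ := exists_crossPairs_meet
    (fun c r => D.vertexMap (P.vert r (![i, j, k] c)))
    (fun g => ⋃ a ∈ gridPart n i j k g, D.curve (P.edge a)) (by
      intro c r
      refine (D.joinedIn_curve (P.edge_col r _ ?_)).mono
        (Set.subset_biUnion_of_mem (u := fun a => D.curve (P.edge a))
          (show (false, r, ![i, j, k] c) ∈ _ from ⟨rfl, rfl, rfl⟩))
      fin_cases c <;> simp <;> omega) (by
      intro c r
      fin_cases c
      · exact P.joinedIn_row D hjk hk.le fun u h h' => ⟨rfl, rfl, h, h'⟩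
      · have hin : i < n := hij.trans (hjk.trans hk)
        have h₁ : JoinedIn (⋃ a ∈ gridPart n i j k (true, 1, r), D.curve (P.edge a))
            (D.vertexMap (P.vert r k)) (D.vertexMap (P.vert r 0)) := by
          rw [← P.vert_self]
          exact P.joinedIn_row D hk le_rfl fun u h h' => ⟨rfl, rfl, h', .inl h⟩
        rcases i.eq_zero_or_pos with rfl | hi
        · exact h₁
        · exact h₁.trans (P.joinedIn_row D hi hin.le
            fun u _ h' => ⟨rfl, rfl, lt_trans (b := i) h' hin, .inr h'⟩)
      · exact P.joinedIn_row D hij (hjk.trans hk).le fun u h h' => ⟨rfl, rfl, h, h'⟩) c r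
  obtain ⟨a, ha, hza⟩ := Set.mem_iUnion₂.1 hz₁
  obtain ⟨b, hb, hzb⟩ := Set.mem_iUnion₂.1 hz₂
  exact ⟨y, hy, _, D.mem_crossings_of_disjoint
    (P.disjoint_edge hij hjk hk (disjoint_of_mem_crossPairs hy) ha hb) hza hzb, a, ha, b, hb, rfl⟩

/-- The crossings between edges of a prism other than the column edges outside `S`. -/
def crossingsOn (S : Finset ℕ) : Set (Sym2 G.edgeSet × (ℝ × ℝ)) :=
  {x ∈ D.crossings | ∃ a b : Bool × Fin 3 × ℕ, (a.2.2 < n ∧ (a.1 = false → a.2.2 ∈ S)) ∧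
    (b.2.2 < n ∧ (b.1 = false → b.2.2 ∈ S)) ∧ x.1 = s(P.edge a, P.edge b)}

theorem mem_of_mem_gridPart {S : Finset ℕ} {i j k : ℕ} (hi : i ∈ S) (hj : j ∈ S) (hk : k ∈ S)
    {g : GridEdge} {a : Bool × Fin 3 × ℕ} (ha : a ∈ gridPart n i j k g) (h : a.1 = false) :
    a.2.2 ∈ S := by
  obtain ⟨_ | _, c, r⟩ := g
  · rw [ha.2.2]
    fin_cases c <;> simpa
  · simp [ha.1] at h

theorem exists_crossing_mem_crossingsOn {S : Finset ℕ} {i j k : ℕ} (hi : i ∈ S) (hj : j ∈ S)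
    (hkS : k ∈ S) (hij : i < j) (hjk : j < k) (hk : k < n) (c r : Fin 3) :
    ∃ y ∈ crossPairs c r, ∃ x ∈ P.crossingsOn D S, ∃ a ∈ gridPart n i j k y.1,
      ∃ b ∈ gridPart n i j k y.2, x.1 = s(P.edge a, P.edge b) := by
  obtain ⟨y, hy, x, hx, a, ha, b, hb, h⟩ := P.exists_crossing D hij hjk hk c r
  exact ⟨y, hy, x, ⟨hx, a, b,
    ⟨lt_of_mem_gridPart hij hjk hk ha, mem_of_mem_gridPart hi hj hkS ha⟩,
    ⟨lt_of_mem_gridPart hij hjk hk hb, mem_of_mem_gridPart hi hj hkS hb⟩, h⟩, a, ha, b, hb, h⟩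

theorem edge_pair_inj (hn : 3 ≤ n) {a b a' b' : Bool × Fin 3 × ℕ} (ha : a.2.2 < n) (hb : b.2.2 < n)
    (ha' : a'.2.2 < n) (hb' : b'.2.2 < n) (h : s(P.edge a, P.edge b) = s(P.edge a', P.edge b')) :
    a = a' ∧ b = b' ∨ a = b' ∧ b = a' :=
  (Sym2.eq_iff.1 h).imp (fun h => ⟨P.edge_inj hn ha ha' h.1, P.edge_inj hn hb hb' h.2⟩)
    (fun h => ⟨P.edge_inj hn ha hb' h.1, P.edge_inj hn hb ha' h.2⟩)

theorem three_le_ncard_crossingsOn (hD : D.crossings.Finite) {S : Finset ℕ} {i j k : ℕ}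
    (hi : i ∈ S) (hj : j ∈ S) (hkS : k ∈ S) (hij : i < j) (hjk : j < k) (hk : k < n) :
    3 ≤ (P.crossingsOn D S).ncard := by
  have hfin : (P.crossingsOn D S).Finite := hD.subset fun x hx => hx.1
  rw [Set.ncard_eq_toFinset_card _ hfin]
  refine three_le_card_of_crossPairs _ (fun x g g' => ∃ a ∈ gridPart n i j k g,
    ∃ b ∈ gridPart n i j k g', x.1 = s(P.edge a, P.edge b)) ?_ ?_
  · rintro x g g' h h' ⟨a, ha, b, hb, hx⟩ ⟨a', ha', b', hb', hx'⟩
    rcases P.edge_pair_inj (by omega) (lt_of_mem_gridPart hij hjk hk ha)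
      (lt_of_mem_gridPart hij hjk hk hb) (lt_of_mem_gridPart hij hjk hk ha')
      (lt_of_mem_gridPart hij hjk hk hb') (hx.symm.trans hx') with ⟨rfl, rfl⟩ | ⟨rfl, rfl⟩
    · exact .inl ⟨eq_of_mem_gridPart hij hjk ha' ha, eq_of_mem_gridPart hij hjk hb' hb⟩
    · exact .inr ⟨eq_of_mem_gridPart hij hjk ha' hb, eq_of_mem_gridPart hij hjk hb' ha⟩
  · intro c r
    obtain ⟨y, hy, x, hx, h⟩ := P.exists_crossing_mem_crossingsOn D hi hj hkS hij hjk hk c r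
    exact ⟨y, hy, x, hfin.mem_toFinset.2 hx, h⟩

end Prism

/-- `u` lies in the `q`-th of the `m` cyclic intervals cut out by `f 0 < ⋯ < f (m - 1)`. -/
def CyclicGap (f : ℕ → ℕ) (m q u : ℕ) : Prop :=
  q + 1 < m ∧ f q ≤ u ∧ u < f (q + 1) ∨ q + 1 = m ∧ (f q ≤ u ∨ u < f 0)

theorem CyclicGap.unique {f : ℕ → ℕ} {m q q' u : ℕ} (hf : ∀ i j, i < j → j < m → f i < f j)
    (h : CyclicGap f m q u) (h' : CyclicGap f m q' u) : q = q' := by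
  have key {q q' : ℕ} (h : CyclicGap f m q u) (h' : CyclicGap f m q' u) : ¬ q < q' := by
    intro hlt
    have hmono {i j : ℕ} (hij : i ≤ j) (hj : j < m) : f i ≤ f j :=
      hij.eq_or_lt.elim (fun h => h ▸ le_rfl) fun h => (hf i j h hj).le
    have hq' : q' < m := by unfold CyclicGap at h'; omega
    have h₁ := hmono (Nat.succ_le_of_lt hlt) hq'
    have h₂ := hmono q.zero_le (hlt.trans hq')
    unfold CyclicGap at h h'
    simp only [Nat.succ_eq_add_one] at h₁
    omega
  exact le_antisymm (not_lt.1 (key h' h)) (not_lt.1 (key h h'))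

/-- Each of `m` increasing numbers is one of three of them such that the segments next to it are
contained in the adjacent cyclic intervals. -/
theorem exists_rowSegment_subset {f : ℕ → ℕ} {m n q : ℕ} (hm : 3 ≤ m) (hq : q < m)  :
    ∃ a b d, a < b ∧ b < d ∧ d < m ∧ ∃ c : Fin 3,
      (∀ u ∈ rowSegment n (f a) (f b) (f d) (c + 1),
        CyclicGap f m (if q = 0 then m - 1 else q - 1) u) ∧
      ∀ u ∈ rowSegment n (f a) (f b) (f d) (c + 2), CyclicGap f m q u := by
  obtain rfl | hq₀ := q.eq_zero_or_pos
  · refine ⟨0, 1, m - 1, by omega, by omega, by omega, 0, fun u hu => ?_, fun u hu => ?_⟩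
    · exact .inr ⟨by simp; omega, hu.2⟩
    · exact .inl ⟨by omega, hu⟩
  rw [if_neg hq₀.ne']
  obtain ⟨q, rfl⟩ := Nat.exists_eq_add_of_lt hq₀
  simp only [zero_add, add_tsub_cancel_right] at *
  obtain h | h := (Nat.succ_le_of_lt hq).lt_or_eq
  · exact ⟨q, q + 1, q + 2, by omega, by omega, by omega, 1, fun u hu => .inl ⟨by omega, hu⟩,
      fun u hu => .inl ⟨by omega, hu⟩⟩
  · exact ⟨0, q, q + 1, by omega, by omega, by omega, 2, fun u hu => .inl ⟨by omega, hu⟩,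
      fun u hu => .inr ⟨by omega, hu.2⟩⟩

namespace Prism

variable {V : Type*} {G : SimpleGraph V} {n : ℕ} (P : Prism G n) (D : Drawing G)

theorem card_le_ncard_of_forall_row (hn : 3 ≤ n) (hD : D.crossings.Finite) {S : Finset ℕ}
    (hS : ∀ s ∈ S, s < n) (hcard : 3 ≤ S.card)
    (hrow : ∀ a b : Bool × Fin 3 × ℕ, (∃ x ∈ P.crossingsOn D S, x.1 = s(P.edge a, P.edge b)) →
      (a.1 = false → a.2.2 ∉ S) ∧ (b.1 = false → b.2.2 ∉ S)) :
    S.card ≤ (P.crossingsOn D S).ncard := by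
  have hfin : (P.crossingsOn D S).Finite := hD.subset fun x hx => hx.1
  set m := S.card with hm
  let f (q : ℕ) : ℕ := if h : q < m then S.orderEmbOfFin rfl ⟨q, h⟩ else 0
  have hfS {q : ℕ} (hq : q < m) : f q ∈ S := by
    simp only [f, dif_pos hq]
    exact S.orderEmbOfFin_mem rfl _
  have hf (i j : ℕ) (hij : i < j) (hj : j < m) : f i < f j := by
    simp only [f, dif_pos hj, dif_pos (hij.trans hj)]
    exact (S.orderEmbOfFin rfl).strictMono hij
  have hx (q : ℕ) (hq : q < m) : ∃ x ∈ P.crossingsOn D S, ∃ a b : Bool × Fin 3 × ℕ,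
      a.2.2 < n ∧ b.2.2 < n ∧ x.1 = s(P.edge a, P.edge b) ∧
      CyclicGap f m (if q = 0 then m - 1 else q - 1) a.2.2 ∧ CyclicGap f m q b.2.2 := by
    obtain ⟨i, j, k, hij, hjk, hk, c, h₁, h₂⟩ := exists_rowSegment_subset (f := f) (n := n) hcard hq
    have hi := hfS (hij.trans (hjk.trans hk))
    have hj := hfS (hjk.trans hk)
    have hkn := hS _ (hfS hk)
    replace hij := hf i j hij (hjk.trans hk)
    replace hjk := hf j k hjk hk
    obtain ⟨⟨g, g'⟩, hy, x, hx, a, ha, b, hb, hxab⟩ :=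
      P.exists_crossing_mem_crossingsOn D hi hj (hfS hk) hij hjk hkn c 0
    have hrow' := hrow a b ⟨x, hx, hxab⟩
    have ha' := lt_of_mem_gridPart hij hjk hkn ha
    have hb' := lt_of_mem_gridPart hij hjk hkn hb
    have hg : g.1 = true := by
      have := mem_of_mem_gridPart hi hj (hfS hk) ha
      obtain ⟨_ | _, _, _⟩ := g
      exacts [(hrow'.1 ha.1 (this ha.1)).elim, rfl]
    have hg' : g'.1 = true := by
      have := mem_of_mem_gridPart hi hj (hfS hk) hb
      obtain ⟨_ | _, _, _⟩ := g'
      exacts [(hrow'.2 hb.1 (this hb.1)).elim, rfl]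
    have hc := row_pair_of_mem_crossPairs hy hg hg'
    obtain ⟨_, d, r⟩ := g
    obtain ⟨_, d', r'⟩ := g'
    simp only at hg hg' hc
    subst hg hg'
    rcases hc with ⟨rfl, rfl⟩ | ⟨rfl, rfl⟩
    · exact ⟨x, hx, a, b, ha', hb', hxab, h₁ _ ha.2.2, h₂ _ hb.2.2⟩
    · exact ⟨x, hx, b, a, hb', ha', hxab.trans Sym2.eq_swap, h₁ _ hb.2.2, h₂ _ ha.2.2⟩
  choose x hxS a b ha hb hxab hga hgb using hx
  rw [← Fintype.card_fin m, ← Nat.card_eq_fintype_card, ← Nat.card_coe_set_eq]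
  have := hfin.to_subtype
  refine Nat.card_le_card_of_injective (fun q : Fin m => (⟨x q q.2, hxS q q.2⟩ :
    P.crossingsOn D S)) fun q q' h => Fin.ext ?_
  have hqq := congrArg (fun y => y.1.1) h
  simp only [hxab] at hqq
  rcases P.edge_pair_inj hn (ha _ _) (hb _ _) (ha _ _) (hb _ _) hqq with ⟨-, h₂⟩ | ⟨h₁, h₂⟩
  · exact (hgb q q.2).unique hf (h₂ ▸ hgb q' q'.2)
  · have h₁ := (hga q q.2).unique hf (h₁ ▸ hgb q' q'.2)
    have h₂ := (hgb q q.2).unique hf (h₂ ▸ hga q' q'.2)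
    have := q.2
    have := q'.2
    split_ifs at h₁ h₂ <;> omega

theorem card_le_ncard_crossingsOn (hn : 3 ≤ n) (hD : D.crossings.Finite) (S : Finset ℕ)
    (hS : ∀ s ∈ S, s < n) (hcard : 3 ≤ S.card) : S.card ≤ (P.crossingsOn D S).ncard := by
  induction S using Finset.strongInduction with
  | H S ih =>
    have hfin : (P.crossingsOn D S).Finite := hD.subset fun x hx => hx.1
    rcases hcard.eq_or_lt with h3 | h4
    · let f := S.orderEmbOfFin h3.symm
      have hf := f.strictMono
      rw [← h3]
      exact P.three_le_ncard_crossingsOn D hD (S.orderEmbOfFin_mem h3.symm 0)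
        (S.orderEmbOfFin_mem h3.symm 1) (S.orderEmbOfFin_mem h3.symm 2) (hf (by decide))
        (hf (by decide)) (hS _ (S.orderEmbOfFin_mem h3.symm 2))
    have herase (x : Sym2 G.edgeSet × (ℝ × ℝ)) (hx : x ∈ P.crossingsOn D S)
        (a b : Bool × Fin 3 × ℕ) (hxab : x.1 = s(P.edge a, P.edge b)) (ha : a.1 = false)
        (haS : a.2.2 ∈ S) : S.card ≤ (P.crossingsOn D S).ncard := by
      have hssub : P.crossingsOn D (S.erase a.2.2) ⊂ P.crossingsOn D S := by
        refine Set.ssubset_iff_exists.2 ⟨?_, x, hx, ?_⟩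
        · rintro y ⟨hy, a', b', ⟨ha', ha''⟩, ⟨hb', hb''⟩, h⟩
          exact ⟨hy, a', b', ⟨ha', fun h => Finset.mem_of_mem_erase (ha'' h)⟩,
            ⟨hb', fun h => Finset.mem_of_mem_erase (hb'' h)⟩, h⟩
        · rintro ⟨-, a', b', ⟨ha', ha''⟩, ⟨hb', hb''⟩, h⟩
          rcases Sym2.eq_iff.1 (hxab.symm.trans h) with ⟨h, -⟩ | ⟨h, -⟩
          · obtain rfl := P.edge_inj hn (hS _ haS) ha' h
            simpa using ha'' ha
          · obtain rfl := P.edge_inj hn (hS _ haS) hb' h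
            simpa using hb'' ha
      have h₁ := Set.ncard_lt_ncard hssub hfin
      have h₂ := Finset.card_erase_of_mem haS
      have h₃ := ih (S.erase a.2.2) (Finset.erase_ssubset haS)
        (fun s hs => hS s (Finset.mem_of_mem_erase hs)) (by omega)
      omega
    by_contra hlt
    refine hlt (P.card_le_ncard_of_forall_row D hn hD hS hcard ?_)
    rintro a b ⟨x, hx, hxab⟩
    exact ⟨fun h h' => hlt (herase x hx a b hxab h h'),
      fun h h' => hlt (herase x hx b a (hxab.trans Sym2.eq_swap) h h')⟩

theorem le_ncard_crossingsOn_range (hn : 3 ≤ n) (hD : D.crossings.Finite) :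
    n ≤ (P.crossingsOn D (Finset.range n)).ncard := by
  simpa using P.card_le_ncard_crossingsOn D hn hD (Finset.range n)
    (fun s hs => Finset.mem_range.1 hs) (by simpa)

end Prism

/-- The prism in `H □ Cₙ` given by a triangle of `H`. -/
def Prism.ofTriangle {W : Type*} {H : SimpleGraph W} (t : Fin 3 → W)
    (ht : ∀ r r', r ≠ r' → H.Adj (t r) (t r')) {n : ℕ} [NeZero n] (hn : 2 ≤ n) :
    Prism (H □ cycleGraph n) n where
  vert r u := (t r, Fin.ofNat n u)
  vert_self r := by simp [Fin.ofNat]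
  vert_inj r r' u u' hu hu' h := by
    obtain ⟨h₁, h₂⟩ := Prod.mk.inj h
    refine ⟨by_contra fun hr => H.ne_of_adj (ht r r' hr) h₁, ?_⟩
    simpa [Fin.ext_iff, Fin.ofNat, Nat.mod_eq_of_lt hu, Nat.mod_eq_of_lt hu'] using h₂
  edge
    | (false, r, u) => ⟨s((t (r + 1), Fin.ofNat n u), (t (r + 2), Fin.ofNat n u)),
        boxProd_adj.2 (.inl ⟨ht _ _ (by decide +revert), rfl⟩)⟩
    | (true, r, u) => ⟨s((t r, Fin.ofNat n u), (t r, Fin.ofNat n (u + 1))),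
        boxProd_adj.2 (.inr ⟨cycleGraph_adj'.2 (.inr (by
          have h : Fin.ofNat n (u + 1) = Fin.ofNat n u + 1 := by
            simp [Fin.ext_iff, Fin.ofNat, Fin.val_add]
          rw [h, add_sub_cancel_left, Fin.val_one', Nat.mod_eq_of_lt hn])), rfl⟩)⟩
  edge_col _ _ _ := rfl
  edge_row _ _ _ := rfl

theorem Prism.exists_mem_edge_ofTriangle {W : Type*} {H : SimpleGraph W} (t : Fin 3 → W)
    (ht : ∀ r r', r ≠ r' → H.Adj (t r) (t r')) {n : ℕ} [NeZero n] (hn : 2 ≤ n)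
    (a : Bool × Fin 3 × ℕ) {w : W × Fin n}
    (hw : w ∈ ((Prism.ofTriangle t ht hn).edge a : Sym2 (W × Fin n))) : ∃ r, t r = w.1 := by
  obtain ⟨_ | _, r, u⟩ := a <;> rcases Sym2.mem_iff.1 hw with rfl | rfl <;> exact ⟨_, rfl⟩

/-- Two disjoint triangles in `H` force `2n` crossings in every drawing of `H □ Cₙ`. -/
theorem two_mul_le_ncard_crossings {W : Type*} {H : SimpleGraph W} (t t' : Fin 3 → W)
    (ht : ∀ r r', r ≠ r' → H.Adj (t r) (t r')) (ht' : ∀ r r', r ≠ r' → H.Adj (t' r) (t' r'))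
    (htt' : ∀ r r', t r ≠ t' r') {n : ℕ} (hn : 3 ≤ n) (D : Drawing (H □ cycleGraph n))
    (hD : D.crossings.Finite) : 2 * n ≤ D.crossings.ncard := by
  have : NeZero n := ⟨by omega⟩
  have hn₂ : 2 ≤ n := by omega
  have h₁ := (Prism.ofTriangle t ht hn₂).le_ncard_crossingsOn_range D hn hD
  have h₂ := (Prism.ofTriangle t' ht' hn₂).le_ncard_crossingsOn_range D hn hD
  set X := (Prism.ofTriangle t ht hn₂).crossingsOn D (Finset.range n)
  set Y := (Prism.ofTriangle t' ht' hn₂).crossingsOn D (Finset.range n)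
  have hX : X ⊆ D.crossings := fun x hx => hx.1
  have hY : Y ⊆ D.crossings := fun x hx => hx.1
  have hXY : Disjoint X Y := by
    refine Set.disjoint_left.2 ?_
    rintro x ⟨-, a, b, -, -, h⟩ ⟨-, a', b', -, -, h'⟩
    have hne (a a' : Bool × Fin 3 × ℕ) :
        (Prism.ofTriangle t ht hn₂).edge a ≠ (Prism.ofTriangle t' ht' hn₂).edge a' := by
      intro h
      have hw := Sym2.out_fst_mem ((Prism.ofTriangle t ht hn₂).edge a : Sym2 (W × Fin n))
      obtain ⟨r, hr⟩ := Prism.exists_mem_edge_ofTriangle t ht hn₂ a hw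
      rw [h] at hw hr
      obtain ⟨r', hr'⟩ := Prism.exists_mem_edge_ofTriangle t' ht' hn₂ a' hw
      exact htt' r r' (hr.trans hr'.symm)
    rcases Sym2.eq_iff.1 (h.symm.trans h') with ⟨h, -⟩ | ⟨h, -⟩
    exacts [hne _ _ h, hne _ _ h]
  have h := Set.ncard_union_eq hXY (hD.subset hX) (hD.subset hY)
  have := Set.ncard_le_ncard (Set.union_subset hX hY) hD
  omega

/-- The point of the plane at distance `ρ` from the origin, at an angle of `φ` parts in `n` of a
full turn. -/
noncomputable def polarPoint (n : ℕ) (ρ φ : ℝ) : ℝ × ℝ :=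
  (ρ * Real.cos (2 * Real.pi * φ / n), ρ * Real.sin (2 * Real.pi * φ / n))

theorem continuous_polarPoint {X : Type*} [TopologicalSpace X] (n : ℕ) {f g : X → ℝ}
    (hf : Continuous f) (hg : Continuous g) : Continuous fun x => polarPoint n (f x) (g x) := by
  unfold polarPoint
  fun_prop

theorem polarPoint_add_self {n : ℕ} (hn : n ≠ 0) (ρ φ : ℝ) :
    polarPoint n ρ (φ + n) = polarPoint n ρ φ := by
  have h : 2 * Real.pi * (φ + n) / n = 2 * Real.pi * φ / n + 2 * Real.pi := by
    field_simp
  simp [polarPoint, h]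

theorem polarPoint_inj {n : ℕ} (hn : n ≠ 0) {ρ ρ' φ φ' : ℝ} (hρ : 0 < ρ) (hρ' : 0 < ρ')
    (h : polarPoint n ρ φ = polarPoint n ρ' φ') : ρ = ρ' ∧ ∃ k : ℤ, φ - φ' = k * n := by
  obtain ⟨h₁, h₂⟩ := Prod.mk.inj h
  have hsq : ρ ^ 2 = ρ' ^ 2 := by
    have e₁ := Real.cos_sq_add_sin_sq (2 * Real.pi * φ / n)
    have e₂ := Real.cos_sq_add_sin_sq (2 * Real.pi * φ' / n)
    calc ρ ^ 2 = (ρ * Real.cos (2 * Real.pi * φ / n)) ^ 2 +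
          (ρ * Real.sin (2 * Real.pi * φ / n)) ^ 2 := by linear_combination -ρ ^ 2 * e₁
      _ = ρ' ^ 2 := by rw [h₁, h₂]; linear_combination ρ' ^ 2 * e₂
  obtain rfl : ρ = ρ' := by nlinarith
  refine ⟨rfl, ?_⟩
  obtain ⟨k, hk⟩ := Real.Angle.angle_eq_iff_two_pi_dvd_sub.1
    (Real.Angle.cos_sin_inj (mul_left_cancel₀ hρ.ne' h₁) (mul_left_cancel₀ hρ.ne' h₂))
  refine ⟨k, ?_⟩
  have hn' : (n : ℝ) ≠ 0 := Nat.cast_ne_zero.2 hn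
  have hpi := Real.pi_ne_zero
  field_simp at hk
  linear_combination hk

/-- The angular displacement along an edge joining two circles that are `d` steps apart. -/
noncomputable def bulge (d : ℕ) (t : ℝ) : ℝ := if d = 0 then t else (d - 1) * (t * (1 - t))

/-- The drawing of an edge that starts at the vertex `(r, j)` and rises by `d` circles. -/
noncomputable def labelArc (n : ℕ) (l : ℕ × ℕ × ℕ) (t : ℝ) : ℝ × ℝ :=
  polarPoint n (l.1 + 1 + l.2.1 * t) (l.2.2 + bulge l.2.1 t)

/-- `IsLabel e (r, d, j)` says that the edge `e` joins `(r, j)` to `(r + d, j)` if `d ≠ 0`, and to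
`(r, j + 1)` otherwise. -/
def IsLabel {n : ℕ} (e : Sym2 (Fin 6 × Fin n)) (l : ℕ × ℕ × ℕ) : Prop :=
  ∃ (r r' : Fin 6) (j j' : Fin n), e = s((r, j), (r', j')) ∧ l.1 = r ∧ l.2.2 = j ∧
    (r' : ℕ) = r + l.2.1 ∧ (l.2.1 = 0 ∨ l.2.1 = 1 ∨ l.2.1 = 2 ∧ (r = 0 ∨ r = 3)) ∧
    (l.2.1 = 0 → (j' : ℕ) = j + 1 ∨ (j : ℕ) + 1 = n ∧ (j' : ℕ) = 0) ∧ (l.2.1 ≠ 0 → j' = j)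

theorem IsLabel.unique {n : ℕ} {e f : Sym2 (Fin 6 × Fin n)} {l : ℕ × ℕ × ℕ} (he : IsLabel e l)
    (hf : IsLabel f l) : e = f := by
  obtain ⟨r, r', j, j', rfl, hr, hj, hr', -, h₁, h₂⟩ := he
  obtain ⟨s, s', i, i', rfl, hs, hi, hs', -, h₃, h₄⟩ := hf
  obtain rfl : r = s := by omega
  obtain rfl : j = i := by omega
  obtain rfl : r' = s' := by omega
  obtain rfl : j' = i' := by
    by_cases h : l.2.1 = 0
    · have := h₁ h
      have := h₃ h
      omega
    · rw [h₂ h, h₄ h]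
  rfl

theorem exists_isLabel {n : ℕ} (hn : 2 ≤ n) (e : (G6_77 □ cycleGraph n).edgeSet) :
    ∃ l, IsLabel (e : Sym2 (Fin 6 × Fin n)) l := by
  have : NeZero n := ⟨by omega⟩
  obtain ⟨⟨⟨r, j⟩, ⟨r', j'⟩⟩, he⟩ := e
  have hG (r r' : Fin 6) (h : G6_77.Adj r r') :
      ((r' : ℕ) = r + 1 ∨ (r' : ℕ) = r + 2 ∧ (r = 0 ∨ r = 3)) ∨
      ((r : ℕ) = r' + 1 ∨ (r : ℕ) = r' + 2 ∧ (r' = 0 ∨ r' = 3)) := by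
    simp only [G6_77, fromEdgeSet_adj, Set.mem_insert_iff, Set.mem_singleton_iff] at h
    revert r r'
    decide +kernel
  have hC (j j' : Fin n) (h : (j' - j).val = 1) :
      (j' : ℕ) = j + 1 ∨ (j : ℕ) + 1 = n ∧ (j' : ℕ) = 0 := by
    have h' : (j' : ℕ) = (j + 1) % n := by
      rw [← h, ← Fin.val_add, add_sub_cancel]
    rcases (Nat.succ_le_of_lt j.2).lt_or_eq with hj | hj
    · exact .inl (h'.trans (Nat.mod_eq_of_lt hj))
    · exact .inr ⟨hj, by rw [h', show (j : ℕ) + 1 = n from hj, Nat.mod_self]⟩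
  change s((r, j), (r', j')) ∈ _ at he
  change ∃ l, IsLabel s((r, j), (r', j')) l
  rcases boxProd_adj.1 he with ⟨h, hj⟩ | ⟨h, hr⟩
  · obtain rfl : j = j' := hj
    rcases hG r r' h with (h | ⟨h, h'⟩) | (h | ⟨h, h'⟩)
    · exact ⟨(r, 1, j), r, r', j, j, rfl, rfl, rfl, h, by simp⟩
    · exact ⟨(r, 2, j), r, r', j, j, rfl, rfl, rfl, h, by simp [h']⟩
    · exact ⟨(r', 1, j), r', r, j, j, Sym2.eq_swap, rfl, rfl, h, by simp⟩
    · exact ⟨(r', 2, j), r', r, j, j, Sym2.eq_swap, rfl, rfl, h, by simp [h']⟩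
  · obtain rfl : r = r' := hr
    rcases cycleGraph_adj'.1 h with h | h
    · exact ⟨(r, 0, j'), r, r, j', j, Sym2.eq_swap, rfl, rfl, rfl, by simp, fun _ => hC _ _ h,
        by simp⟩
    · exact ⟨(r, 0, j), r, r, j, j', rfl, rfl, rfl, rfl, by simp, fun _ => hC _ _ h, by simp⟩

/-- The labels of edges of `G6_77 □ Cₙ`, as far as they matter for the drawing. -/
def ValidLabel (n : ℕ) (l : ℕ × ℕ × ℕ) : Prop :=
  l.2.2 < n ∧ (l.2.1 = 0 ∨ l.2.1 = 1 ∨ l.2.1 = 2 ∧ (l.1 = 0 ∨ l.1 = 3))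

theorem IsLabel.validLabel {n : ℕ} {e : Sym2 (Fin 6 × Fin n)} {l : ℕ × ℕ × ℕ} (h : IsLabel e l) :
    ValidLabel n l := by
  obtain ⟨r, r', j, j', -, hr, hj, -, hd, -⟩ := h
  refine ⟨by omega, ?_⟩
  rcases hd with h | h | ⟨h, rfl | rfl⟩ <;> simp [h, hr]

theorem bulge_mem {d : ℕ} (hd : d ≤ 2) {t : ℝ} (ht : t ∈ Set.Ioo (0 : ℝ) 1) :
    bulge d t ∈ Set.Ico (0 : ℝ) 1 := by
  obtain ⟨h₀, h₁⟩ := ht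
  interval_cases d <;> simp [bulge] <;> constructor <;> nlinarith

/-- Angles in two cells of the plane agree only if they are equal. -/
theorem eq_of_sub_eq_mul {n i j : ℕ} (hi : i < n) (hj : j < n) {s t : ℝ}
    (hs : s ∈ Set.Ico (0 : ℝ) 1) (ht : t ∈ Set.Ico (0 : ℝ) 1) {k : ℤ}
    (h : (i + s) - (j + t) = k * n) : i = j ∧ s = t := by
  obtain ⟨hs₀, hs₁⟩ := hs
  obtain ⟨ht₀, ht₁⟩ := ht
  have hst : s - t = ((k * n - i + j : ℤ) : ℝ) := by push_cast; linear_combination h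
  have hz : k * n - i + j = 0 := by
    have h₁ : (-1 : ℝ) < ((k * n - i + j : ℤ) : ℝ) := by rw [← hst]; linarith
    have h₂ : ((k * n - i + j : ℤ) : ℝ) < 1 := by rw [← hst]; linarith
    have h₁' : -1 < k * n - i + j := by exact_mod_cast h₁
    have h₂' : k * n - i + j < 1 := by exact_mod_cast h₂
    omega
  have hk : k = 0 := by
    have h₁ : k * n < 1 * n := by omega
    have h₂ : -1 * n < k * n := by omega
    have h₁' := lt_of_mul_lt_mul_right h₁ (by omega)
    have h₂' := lt_of_mul_lt_mul_right h₂ (by omega)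
    omega
  rw [hz, Int.cast_zero] at hst
  subst hk
  exact ⟨by omega, by linarith⟩

theorem ValidLabel.le_two {n : ℕ} {l : ℕ × ℕ × ℕ} (h : ValidLabel n l) : l.2.1 ≤ 2 := by
  have := h.2
  omega

theorem polarPoint_inj_of_mem {n i j : ℕ} (hi : i < n) (hj : j < n) {ρ ρ' s t : ℝ} (hρ : 0 < ρ)
    (hρ' : 0 < ρ') (hs : s ∈ Set.Ico (0 : ℝ) 1) (ht : t ∈ Set.Ico (0 : ℝ) 1)
    (h : polarPoint n ρ (i + s) = polarPoint n ρ' (j + t)) : ρ = ρ' ∧ i = j ∧ s = t := by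
  obtain ⟨h₁, k, hk⟩ := polarPoint_inj (by omega) hρ hρ' h
  exact ⟨h₁, eq_of_sub_eq_mul hi hj hs ht hk⟩

/-- Two edges meet in their interiors only where an edge `(r + 1, 0, j)` meets the middle of an edge
`(r, 2, j)`. -/
theorem labelArc_eq {n : ℕ} {l l' : ℕ × ℕ × ℕ} (hl : ValidLabel n l) (hl' : ValidLabel n l')
    (hd : l.2.1 ≤ l'.2.1) {t t' : ℝ} (ht : t ∈ Set.Ioo (0 : ℝ) 1) (ht' : t' ∈ Set.Ioo (0 : ℝ) 1)
    (h : labelArc n l t = labelArc n l' t') :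
    l = l' ∨ (l'.1 = 0 ∨ l'.1 = 3) ∧ l = (l'.1 + 1, 0, l'.2.2) ∧ l'.2.1 = 2 ∧
      labelArc n l t = polarPoint n (l'.1 + 2) (l'.2.2 + 1 / 4) := by
  have hb := bulge_mem hl.le_two ht
  have hb' := bulge_mem hl'.le_two ht'
  obtain ⟨r, d, j⟩ := l
  obtain ⟨r', d', j'⟩ := l'
  obtain ⟨ht₀, ht₁⟩ := ht
  obtain ⟨ht₀', ht₁'⟩ := ht'
  obtain ⟨hj, hdr⟩ := hl
  obtain ⟨hj', hdr'⟩ := hl'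
  simp only at *
  obtain ⟨hρ, rfl, hψ⟩ := polarPoint_inj_of_mem hj hj' (by simp only; positivity)
    (by simp only; positivity) hb hb' h
  simp only at hρ hψ
  have hfloor {a b : ℕ} {x y : ℝ} (hx : 0 < x) (hx₁ : x < 1) (hy : 0 < y) (hy₁ : y < 1)
      (hab : (a : ℝ) + x = b + y) : a = b := by
    have h₁ : (a : ℝ) < b + 1 := by linarith
    have h₂ : (b : ℝ) < a + 1 := by linarith
    have h₁' : a < b + 1 := by exact_mod_cast h₁
    have h₂' : b < a + 1 := by exact_mod_cast h₂
    omega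
  rcases hdr with rfl | rfl | ⟨rfl, hr⟩ <;> rcases hdr' with rfl | rfl | ⟨rfl, hr'⟩ <;>
    simp [bulge] at hd hψ hρ
  · exact .inl (by rw [hρ])
  · linarith
  · right
    have h₁ : (r' : ℝ) < r := by linarith
    have h₂ : (r : ℝ) < r' + 2 := by linarith
    have h₁' : r' < r := by exact_mod_cast h₁
    have h₂' : r < r' + 2 := by exact_mod_cast h₂
    obtain rfl : r = r' + 1 := by omega
    push_cast at hρ
    obtain rfl : t' = 1 / 2 := by linarith
    refine ⟨hr', rfl, rfl, ?_⟩
    rw [labelArc, bulge, hψ]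
    push_cast
    congr 1 <;> norm_num <;> ring
  · have hr₀ : r = r' := hfloor ht₀ ht₁ ht₀' ht₁' (by linarith)
    exact .inl (by rw [hr₀])
  · rcases hψ with h | h | h <;> linarith
  · left
    rcases hr with rfl | rfl <;> rcases hr' with rfl | rfl
    · rfl
    · norm_num at hρ; linarith
    · norm_num at hρ; linarith
    · rfl

theorem labelArc_ne_vertex {n : ℕ} {l : ℕ × ℕ × ℕ} (hl : ValidLabel n l) {t : ℝ}
    (ht : t ∈ Set.Ioo (0 : ℝ) 1) {s i : ℕ} (hi : i < n) :
    labelArc n l t ≠ polarPoint n (s + 1) i := by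
  intro h
  have hb := bulge_mem hl.le_two ht
  obtain ⟨r, d, j⟩ := l
  obtain ⟨hj, hdr⟩ := hl
  rw [← add_zero (i : ℝ)] at h
  have ht₀ := ht.1
  have ht₁ := ht.2
  obtain ⟨hρ, rfl, hψ⟩ := polarPoint_inj_of_mem hj hi (by simp only; positivity)
    (by positivity) hb (by simp) h
  simp only at hρ hψ hdr
  rcases hdr with rfl | rfl | ⟨rfl, -⟩ <;> simp [bulge] at hψ hρ
  · linarith
  · have h₁ : (r : ℝ) < s := by linarith
    have h₂ : (s : ℝ) < r + 1 := by linarith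
    have h₁' : r < s := by exact_mod_cast h₁
    have h₂' : s < r + 1 := by exact_mod_cast h₂
    omega
  · rcases hψ with h | h | h <;> linarith

theorem labelArc_injOn {n : ℕ} (hn : 2 ≤ n) {l : ℕ × ℕ × ℕ} :
    Set.InjOn (labelArc n l) (Set.Icc 0 1) := by
  obtain ⟨r, d, j⟩ := l
  rintro t ⟨ht₀, ht₁⟩ t' ⟨ht₀', ht₁'⟩ h
  obtain ⟨hρ, k, hk⟩ := polarPoint_inj (by omega) (by simp only; positivity)
    (by simp only; positivity) h
  simp only at hρ hk
  by_cases hd : d = 0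
  · simp only [hd, bulge, if_true] at hk
    have hn' : (2 : ℝ) ≤ n := by exact_mod_cast hn
    have h₁ : (k : ℝ) < 1 := by nlinarith
    have h₂ : (-1 : ℝ) < k := by nlinarith
    obtain rfl : k = 0 := by
      have h₁' : k < 1 := by exact_mod_cast h₁
      have h₂' : -1 < k := by exact_mod_cast h₂
      omega
    push_cast at hk
    linarith
  · have hd' : (d : ℝ) ≠ 0 := Nat.cast_ne_zero.2 hd
    exact mul_left_cancel₀ hd' (by linarith)

theorem labelArc_zero (n : ℕ) (l : ℕ × ℕ × ℕ) :
    labelArc n l 0 = polarPoint n (l.1 + 1) l.2.2 := by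
  simp [labelArc, bulge]

theorem continuous_labelArc (n : ℕ) (l : ℕ × ℕ × ℕ) : Continuous (labelArc n l) := by
  refine continuous_polarPoint n (by fun_prop) ?_
  unfold bulge
  split_ifs <;> fun_prop

/-- The positions of the vertices of `G6_77 □ Cₙ`. -/
noncomputable def gridPoint {n : ℕ} (v : Fin 6 × Fin n) : ℝ × ℝ :=
  polarPoint n ((v.1 : ℕ) + 1) (v.2 : ℕ)

theorem gridPoint_injective {n : ℕ} : Function.Injective (gridPoint (n := n)) := by
  rintro ⟨r, j⟩ ⟨r', j'⟩ h
  obtain ⟨h₁, h₂, -⟩ := polarPoint_inj_of_mem (s := 0) (t := 0) j.2 j'.2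
    (Nat.cast_add_one_pos r.1) (Nat.cast_add_one_pos r'.1) (by simp) (by simp)
    (by simpa [gridPoint] using h)
  have h₁' : (r : ℕ) = r' := by exact_mod_cast add_right_cancel h₁
  rw [Fin.ext h₁', Fin.ext h₂]

theorem IsLabel.exists_endpoints {n : ℕ} {e : Sym2 (Fin 6 × Fin n)} {l : ℕ × ℕ × ℕ}
    (h : IsLabel e l) :
    ∃ u v, e = s(u, v) ∧ labelArc n l 0 = gridPoint u ∧ labelArc n l 1 = gridPoint v := by
  obtain ⟨r, r', j, j', rfl, hr, hj, hr', hd, h₁, h₂⟩ := h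
  refine ⟨(r, j), (r', j'), rfl, by rw [labelArc_zero, hr, hj]; rfl, ?_⟩
  have hr₁ : (r' : ℝ) + 1 = l.1 + 1 + l.2.1 * 1 := by rw [hr', hr]; push_cast; ring
  by_cases hd : l.2.1 = 0
  · rcases h₁ hd with h | ⟨h, h'⟩
    · simp only [labelArc, gridPoint, hr₁, hj, h]
      simp [bulge, hd]
    · rw [gridPoint, ← polarPoint_add_self (by omega), hr₁]
      simp only [labelArc, hj, h', bulge, hd, if_true]
      have h : (j : ℝ) + 1 = n := by exact_mod_cast h
      simp [h]
  · obtain rfl := h₂ hd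
    simp only [labelArc, gridPoint, hr₁, hj, bulge, hd, if_false]
    simp

/-- The drawing of `G6_77 □ Cₙ` in which the cycles are concentric circles and the chords of
`G6_77` pass around the circle between their endpoints. -/
noncomputable def circularDrawing {n : ℕ} (hn : 2 ≤ n) : Drawing (G6_77 □ cycleGraph n) where
  vertexMap := gridPoint
  vertexMap_injective := gridPoint_injective
  arc e := labelArc n (exists_isLabel hn e).choose
  arc_continuousOn _ := (continuous_labelArc n _).continuousOn
  arc_injOn _ := labelArc_injOn hn
  arc_endpoints e := (exists_isLabel hn e).choose_spec.exists_endpoints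
  arc_avoids_vertices e _ ht w :=
    labelArc_ne_vertex (exists_isLabel hn e).choose_spec.validLabel ht w.2.2

theorem exists_of_mem_crossings_circularDrawing {n : ℕ} (hn : 2 ≤ n)
    {x : Sym2 (G6_77 □ cycleGraph n).edgeSet × (ℝ × ℝ)} (hx : x ∈ (circularDrawing hn).crossings) :
    ∃ p : Bool × Fin n, ∃ e f : (G6_77 □ cycleGraph n).edgeSet,
      IsLabel (e : Sym2 (Fin 6 × Fin n)) (p.1.toNat * 3 + 1, 0, p.2) ∧
      IsLabel (f : Sym2 (Fin 6 × Fin n)) (p.1.toNat * 3, 2, p.2) ∧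
      x = (s(e, f), polarPoint n ((p.1.toNat * 3 : ℕ) + 2) ((p.2 : ℕ) + 1 / 4)) := by
  obtain ⟨x, z⟩ := x
  obtain ⟨e, f, hne, rfl, ⟨s, hs, hsz⟩, t, ht, htz⟩ := hx
  have he := (exists_isLabel hn e).choose_spec
  have hf := (exists_isLabel hn f).choose_spec
  change labelArc n (exists_isLabel hn e).choose s = z at hsz
  change labelArc n (exists_isLabel hn f).choose t = z at htz
  generalize (exists_isLabel hn e).choose = l at *
  generalize (exists_isLabel hn f).choose = l' at *
  wlog hd : l.2.1 ≤ l'.2.1 generalizing e f l l' s t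
  · obtain ⟨p, e', f', he', hf', h⟩ :=
      this f e hne.symm t ht s hs l' hf htz l he hsz (le_of_not_ge hd)
    exact ⟨p, e', f', he', hf', by rw [Sym2.eq_swap, h]⟩
  rcases labelArc_eq he.validLabel hf.validLabel hd hs ht (hsz.trans htz.symm) with rfl |
    ⟨hr, rfl, h₂, hz⟩
  · exact (hne (Subtype.ext (he.unique hf))).elim
  · obtain ⟨r, d, j⟩ := l'
    simp only at *
    subst h₂
    rcases hr with rfl | rfl
    · exact ⟨(false, ⟨j, hf.validLabel.1⟩), e, f, by simpa using he, by simpa using hf,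
        by rw [← hsz, hz]; simp⟩
    · exact ⟨(true, ⟨j, hf.validLabel.1⟩), e, f, by simpa using he, by simpa using hf,
        by rw [← hsz, hz]; simp⟩

theorem ncard_crossings_circularDrawing_le {n : ℕ} (hn : 2 ≤ n) :
    (circularDrawing hn).crossings.Finite ∧ (circularDrawing hn).crossings.ncard ≤ 2 * n := by
  choose p e f he hf hx using fun x : (circularDrawing hn).crossings =>
    exists_of_mem_crossings_circularDrawing hn x.2
  have hp : Function.Injective p := by
    intro x y h
    have h₁ : e x = e y := Subtype.ext ((he x).unique (h ▸ he y))
    have h₂ : f x = f y := Subtype.ext ((hf x).unique (h ▸ hf y))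
    exact Subtype.ext (by rw [hx x, hx y, h₁, h₂, h])
  refine ⟨Set.finite_coe_iff.1 (Finite.of_injective p hp), ?_⟩
  simpa [Nat.card_coe_set_eq] using Nat.card_le_card_of_injective p hp

/-- The crossing number of `G⁶₇₇ □ Cₙ` is `2n` for all `n ≥ 6`. -/
theorem crossingNumber_G6_77_boxProd_cycle (n : ℕ) (hn : 6 ≤ n) :
    crossingNumber (G6_77 □ SimpleGraph.cycleGraph n) = 2 * n := by
  have hlow (D : Drawing (G6_77 □ cycleGraph n)) (hD : D.crossings.Finite) :
      2 * n ≤ D.crossings.ncard := by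
    have hadj (r r' : Fin 3) (h : r ≠ r') :
        G6_77.Adj (![0, 1, 2] r) (![0, 1, 2] r') ∧ G6_77.Adj (![3, 4, 5] r) (![3, 4, 5] r') := by
      simp only [G6_77, fromEdgeSet_adj, Set.mem_insert_iff, Set.mem_singleton_iff]
      revert r r'
      decide +kernel
    exact two_mul_le_ncard_crossings ![0, 1, 2] ![3, 4, 5] (fun r r' h => (hadj r r' h).1)
      (fun r r' h => (hadj r r' h).2) (by decide) (by omega) D hD
  obtain ⟨hfin, hle⟩ := ncard_crossings_circularDrawing_le (n := n) (by omega)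
  have hmem : (circularDrawing (n := n) (by omega)).crossings.ncard ∈
      {m : ℕ | ∃ D : Drawing (G6_77 □ cycleGraph n), D.crossings.Finite ∧ D.crossings.ncard = m} :=
    ⟨_, hfin, rfl⟩
  refine le_antisymm ((Nat.sInf_le hmem).trans hle) (le_csInf ⟨_, hmem⟩ ?_)
  rintro _ ⟨D, hD, rfl⟩
  exact hlow D hD
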